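/- The map G sending a reduced pipe dream P for the permutation 1 n (n-1) ... 2 in S_n to the graph G(P) on vertex set [n] with edge set {(i,j) : there is an elbow in box (n-j+1, i) of P} is a bijection from the set of reduced pipe dreams of 1 n (n-1) ... 2 to the set of noncrossing alternating spanning trees of K_n. -/

import Mathlib

/-!  Pipe dreams and Grothendieck polynomials.  Permutations of `S_n` are modeled as
permutations of `ℕ` fixing every `i ≥ n` (acting on `{0,…,n-1}`). -/

attribute [local instance] Classical.propDecidable

/-- Coxeter length = number of inversions on `{0,…,n-1}`. -/
def permLen (n : ℕ) (w : Equiv.Perm ℕ) : ℕ :=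
  ((Finset.range n ×ˢ Finset.range n).filter (fun p => p.1 < p.2 ∧ w p.2 < w p.1)).card

/-- Boxes of the staircase shape (0-indexed): `(r,c)` with `r + c ≤ n - 2`. -/
def boxes (n : ℕ) : Finset (ℕ × ℕ) :=
  ((Finset.range n) ×ˢ (Finset.range n)).filter (fun b => b.1 + b.2 + 2 ≤ n)

/-- The triangular word, as the list of boxes read row by row, each row right to left.
The box `(r,c)` carries the simple reflection `s_{r+c}` (0-indexed). -/
def triWord (n : ℕ) : List (ℕ × ℕ) :=
  (List.range (n - 1)).flatMap (fun r => ((List.range (n - 1 - r)).reverse).map (fun c => (r, c)))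

/-- Demazure (0-Hecke) product of the simple reflections sitting in the boxes of `S`,
read along the triangular word. -/
noncomputable def demazure (n : ℕ) (S : Finset (ℕ × ℕ)) : Equiv.Perm ℕ :=
  ((triWord n).filter (fun b => decide (b ∈ S))).foldl
    (fun u b =>
      let v := u * Equiv.swap (b.1 + b.2) (b.1 + b.2 + 1)
      if permLen n u < permLen n v then v else u) 1

/-- A (possibly nonreduced) pipe dream for `w ∈ S_n`: a set of crosses in the staircase whose
pipes intertwine according to `w` (extra crossings of a pair of pipes being ignored). -/
def IsPipeDream (n : ℕ) (w : Equiv.Perm ℕ) (P : Finset (ℕ × ℕ)) : Prop :=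
  P ⊆ boxes n ∧ demazure n P = w

/-- A reduced pipe dream: a pipe dream with exactly `ℓ(w)` crosses. -/
def IsReducedPipeDream (n : ℕ) (w : Equiv.Perm ℕ) (P : Finset (ℕ × ℕ)) : Prop :=
  IsPipeDream n w P ∧ P.card = permLen n w

/-- All pipe dreams of `w` (reduced and nonreduced), as a finite set. -/
noncomputable def pipeDreams (n : ℕ) (w : Equiv.Perm ℕ) : Finset (Finset (ℕ × ℕ)) :=
  (boxes n).powerset.filter (fun P => demazure n P = w)

/-- The permutation `1 n (n-1) ⋯ 2 ∈ S_n` (0-indexed: `0 ↦ 0` and `i ↦ n - i` for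
`1 ≤ i ≤ n-1`, identity elsewhere). -/
def piPerm (n : ℕ) : Equiv.Perm ℕ :=
  Function.Involutive.toPerm (fun i => if 1 ≤ i ∧ i < n then n - i else i)
    (by intro i; dsimp only; split_ifs <;> omega)

/-- The simple graph on `ℕ` with the given (increasingly oriented) edge set. -/
def graphOf (E : Finset (ℕ × ℕ)) : SimpleGraph ℕ :=
  SimpleGraph.fromEdgeSet ↑(E.image (fun p => s(p.1, p.2)))

/-- `E` is the edge set of a spanning tree of the complete graph on `{0,…,n-1}`:
all edges are increasingly oriented edges on `{0,…,n-1}`, the graph is acyclic, and any two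
vertices of `{0,…,n-1}` are connected. -/
def IsSpanningTree (n : ℕ) (E : Finset (ℕ × ℕ)) : Prop :=
  (∀ p ∈ E, p.1 < p.2 ∧ p.2 < n) ∧ (graphOf E).IsAcyclic ∧
    ∀ a b, a < n → b < n → (graphOf E).Reachable a b

/-- A graph is noncrossing if there are no vertices `i < j < k < l` with both `(i,k)` and
`(j,l)` edges. -/
def Noncrossing (E : Finset (ℕ × ℕ)) : Prop :=
  ¬ ∃ i j k l, i < j ∧ j < k ∧ k < l ∧ (i, k) ∈ E ∧ (j, l) ∈ E

/-- A graph is alternating if there are no vertices `i < j < k` with both `(i,j)` and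
`(j,k)` edges. -/
def Alternating (E : Finset (ℕ × ℕ)) : Prop :=
  ¬ ∃ i j k, i < j ∧ j < k ∧ (i, j) ∈ E ∧ (j, k) ∈ E


/-- The map sending a box of the staircase to an edge of `K_n`: the (1-indexed) box
`(a,b)` goes to the edge `(i,j)` with `b = i` and `a = n - j + 1`; 0-indexed, the box
`(r,c)` goes to the edge `(c, n - 1 - r)`. -/
def boxEdge (n : ℕ) (b : ℕ × ℕ) : ℕ × ℕ := (b.2, n - 1 - b.1)

/-! ### Reduced runs along a word of boxes -/

lemma permLen_one (n : ℕ) : permLen n 1 = 0 := by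
  simp only [permLen, Finset.card_eq_zero, Finset.filter_eq_empty_iff]
  rintro ⟨a, b⟩ - ⟨h, h'⟩
  simp at h h'
  omega

lemma permLen_mul_swap_of_lt {n p : ℕ} (hp : p + 1 < n) (u : Equiv.Perm ℕ)
    (h : u p < u (p + 1)) :
    permLen n (u * Equiv.swap p (p + 1)) = permLen n u + 1 := by
  set s := Equiv.swap p (p + 1) with hs
  have sval : ∀ x, s x = if x = p then p + 1 else if x = p + 1 then p else x := by
    intro x; rw [hs, Equiv.swap_apply_def]
  have hnot : ((p, p + 1) : ℕ × ℕ) ∉ ((Finset.range n ×ˢ Finset.range n).filter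
      (fun q => q.1 < q.2 ∧ u q.2 < u q.1)).image (fun q => (s q.1, s q.2)) := by
    simp only [Finset.mem_image, Finset.mem_filter, Prod.mk.injEq, not_exists]
    rintro ⟨a, b⟩ ⟨⟨-, hab, -⟩, h1, h2⟩
    simp only [sval] at h1 h2
    grind
  have hinj : Function.Injective (fun q : ℕ × ℕ => (s q.1, s q.2)) :=
    fun q q' h => by simpa [Prod.ext_iff] using h
  unfold permLen
  rw [← Finset.card_image_of_injective (s := (Finset.range n ×ˢ Finset.range n).filter
    (fun q => q.1 < q.2 ∧ u q.2 < u q.1)) hinj, ← Finset.card_insert_of_notMem hnot]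
  congr 1
  ext ⟨a, b⟩
  have hss : ∀ x, s (s x) = x := fun x => Equiv.swap_apply_self _ _ _
  have hmem : (a, b) ∈ ((Finset.range n ×ˢ Finset.range n).filter
      (fun q => q.1 < q.2 ∧ u q.2 < u q.1)).image (fun q => (s q.1, s q.2)) ↔
      (s a < n ∧ s b < n) ∧ s a < s b ∧ u (s b) < u (s a) := by
    simp only [Finset.mem_image, Finset.mem_filter, Finset.mem_product, Finset.mem_range,
      Prod.mk.injEq, Prod.exists]
    constructor
    · rintro ⟨c, d, h, rfl, rfl⟩
      simpa [hss] using h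
    · intro h
      exact ⟨s a, s b, h, hss a, hss b⟩
  rw [Finset.mem_insert, hmem]
  simp only [Equiv.Perm.mul_apply, Prod.mk.injEq]
  have ha := sval a
  have hb := sval b
  by_cases h1 : a = p <;> by_cases h2 : b = p + 1 <;> by_cases h3 : a = p + 1 <;>
    by_cases h4 : b = p <;> simp only [h1, h2, h3, h4, if_true, if_false] at ha hb ⊢ <;>
    grind

lemma permLen_mul_swap_of_gt {n p : ℕ} (hp : p + 1 < n) (u : Equiv.Perm ℕ)
    (h : u (p + 1) < u p) :
    permLen n (u * Equiv.swap p (p + 1)) + 1 = permLen n u := by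
  have := permLen_mul_swap_of_lt hp (u * Equiv.swap p (p + 1)) (by simpa using h)
  rw [mul_assoc, Equiv.swap_mul_self, mul_one] at this
  exact this.symm

/-- Reading the boxes of a word, multiply `u` by the reflections of the boxes in `P`; the run
succeeds if each multiplication increases the length and the resulting permutation satisfies
`K`. -/
def ReducedRun (P : Finset (ℕ × ℕ)) :
    List (ℕ × ℕ) → Equiv.Perm ℕ → (Equiv.Perm ℕ → Prop) → Prop
  | [], u, K => K u
  | b :: l, u, K =>
    if b ∈ P then u (b.1 + b.2) < u (b.1 + b.2 + 1) ∧
      ReducedRun P l (u * Equiv.swap (b.1 + b.2) (b.1 + b.2 + 1)) K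
    else ReducedRun P l u K

lemma reducedRun_append (P : Finset (ℕ × ℕ)) (l l' : List (ℕ × ℕ)) (u : Equiv.Perm ℕ)
    (K : Equiv.Perm ℕ → Prop) :
    ReducedRun P (l ++ l') u K ↔ ReducedRun P l u (fun v => ReducedRun P l' v K) := by
  induction l generalizing u with
  | nil => simp [ReducedRun]
  | cons b l ih => simp only [List.cons_append, ReducedRun, ih]

/-- One step of the Demazure product. -/
noncomputable def demazureStep (n : ℕ) (u : Equiv.Perm ℕ) (b : ℕ × ℕ) : Equiv.Perm ℕ :=
  let v := u * Equiv.swap (b.1 + b.2) (b.1 + b.2 + 1)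
  if permLen n u < permLen n v then v else u

lemma permLen_foldl_demazureStep (n : ℕ) (P : Finset (ℕ × ℕ)) (w : Equiv.Perm ℕ)
    (l : List (ℕ × ℕ)) (hl : ∀ b ∈ l, b.1 + b.2 + 1 < n) (u : Equiv.Perm ℕ) :
    permLen n ((l.filter (fun b => decide (b ∈ P))).foldl (demazureStep n) u) ≤
      permLen n u + (l.filter (fun b => decide (b ∈ P))).length ∧
    (ReducedRun P l u (· = w) ↔
      (l.filter (fun b => decide (b ∈ P))).foldl (demazureStep n) u = w ∧
      permLen n w = permLen n u + (l.filter (fun b => decide (b ∈ P))).length) := by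
  induction l generalizing u with
  | nil => simpa [ReducedRun] using fun h => by rw [h]
  | cons b l ih =>
    have ih := ih (fun b hb => hl b (List.mem_cons_of_mem _ hb))
    have hb := hl b List.mem_cons_self
    by_cases hP : b ∈ P
    · simp only [ReducedRun, hP, if_true, decide_true, List.filter_cons_of_pos, List.foldl_cons,
        List.length_cons]
      rcases lt_trichotomy (u (b.1 + b.2)) (u (b.1 + b.2 + 1)) with h | h | h
      · have hlen := permLen_mul_swap_of_lt hb u h
        have hstep : demazureStep n u b = u * Equiv.swap (b.1 + b.2) (b.1 + b.2 + 1) :=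
          if_pos (by omega)
        have h1 := ih (u * Equiv.swap (b.1 + b.2) (b.1 + b.2 + 1))
        rw [hstep]
        refine ⟨by omega, ?_⟩
        rw [h1.2, hlen]
        simp only [h, true_and]
        exact and_congr_right fun _ => by omega
      · simp at h
      · have hlen := permLen_mul_swap_of_gt hb u h
        have hstep : demazureStep n u b = u := if_neg (by omega)
        have h1 := ih u
        rw [hstep]
        refine ⟨by omega, ⟨fun h' => by omega, ?_⟩⟩
        rintro ⟨rfl, h'⟩
        omega
    · simpa [ReducedRun, hP] using ih u

lemma triWord_nodup (n : ℕ) : (triWord n).Nodup := by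
  unfold triWord
  rw [List.nodup_flatMap]
  refine ⟨fun r _ => ?_, ?_⟩
  · exact (List.nodup_reverse.2 List.nodup_range).map fun a b h => by simpa using h
  · refine List.nodup_range.imp ?_
    rintro a b hab
    simp only [Function.onFun, List.disjoint_left, List.mem_map]
    rintro _ ⟨c, -, rfl⟩ ⟨d, -, h⟩
    simp at h
    omega

lemma mem_triWord {n : ℕ} {b : ℕ × ℕ} : b ∈ triWord n ↔ b ∈ boxes n := by
  obtain ⟨r, c⟩ := b
  simp only [triWord, boxes, List.mem_flatMap, List.mem_map, List.mem_reverse, List.mem_range,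
    Finset.mem_filter, Finset.mem_product, Finset.mem_range, Prod.mk.injEq]
  constructor
  · rintro ⟨a, h, b, h', rfl, rfl⟩
    omega
  · intro h
    exact ⟨r, by omega, c, by omega, rfl, rfl⟩

lemma length_filter_triWord {n : ℕ} {P : Finset (ℕ × ℕ)} (hP : P ⊆ boxes n) :
    ((triWord n).filter (fun b => decide (b ∈ P))).length = P.card := by
  rw [← List.toFinset_card_of_nodup ((triWord_nodup n).filter _)]
  congr 1
  ext b
  simpa [mem_triWord] using fun h => hP h

lemma isReducedPipeDream_iff {n : ℕ} {w : Equiv.Perm ℕ} {P : Finset (ℕ × ℕ)} :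
    IsReducedPipeDream n w P ↔ P ⊆ boxes n ∧ ReducedRun P (triWord n) 1 (· = w) := by
  unfold IsReducedPipeDream IsPipeDream
  rw [and_assoc]
  refine and_congr_right fun hP => ?_
  rw [(permLen_foldl_demazureStep n P w (triWord n) (fun b hb => ?_) 1).2, permLen_one,
    length_filter_triWord hP, zero_add, eq_comm (a := P.card)]
  · rfl
  · have := mem_triWord.1 hb
    simp only [boxes, Finset.mem_filter] at this
    omega

/-! ### Rows of the staircase as sweeps over lists -/

/-- The values `u (a + k - 1), …, u a`. -/
def revVals (u : ℕ → ℕ) (a : ℕ) : ℕ → List ℕ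
  | 0 => []
  | k + 1 => u (a + k) :: revVals u a k

lemma revVals_congr {u v : ℕ → ℕ} {a k : ℕ} (h : ∀ q, a ≤ q → q < a + k → u q = v q) :
    revVals u a k = revVals v a k := by
  induction k with
  | zero => rfl
  | succ k ih =>
    simp only [revVals]
    rw [h _ (by omega) (by omega), ih fun q h1 h2 => h q h1 (by omega)]

lemma length_revVals (u : ℕ → ℕ) (a k : ℕ) : (revVals u a k).length = k := by
  induction k with
  | zero => rfl
  | succ k ih => simp [revVals, ih]

/-- The effect of one row of boxes: a carried value `x` travels along a list. At an elbow (in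
a column satisfying `B`) it is exchanged with the current entry, and at a cross it must exceed
the current entry. `K` is the condition on the resulting list and the last carried value. -/
def Sweep (B : ℕ → Prop) : ℕ → List ℕ → (List ℕ → ℕ → Prop) → Prop
  | x, [], K => K [] x
  | x, y :: ys, K =>
    if B ys.length then Sweep B y ys (fun l t => K (x :: l) t)
    else y < x ∧ Sweep B x ys (fun l t => K (y :: l) t)

/-- Successive sweeps along rows with top vertices `j, j - 1, …`, each of which has to move the
largest remaining value to the end. -/
def Sweeps (E : ℕ → ℕ → Prop) : ℕ → List ℕ → Prop
  | 0, _ => True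
  | _ + 1, [] => False
  | j + 1, x :: ys => Sweep (E · j) x ys (fun l t => t = j + 1 ∧ Sweeps E j l)

/-- The first `k` boxes of the row `r`, from right to left. -/
def rowWord (r k : ℕ) : List (ℕ × ℕ) := (List.range k).reverse.map (fun c => (r, c))

lemma rowWord_succ (r k : ℕ) : rowWord r (k + 1) = (r, k) :: rowWord r k := by
  simp [rowWord, List.range_succ]

/-- The boxes of `d` successive rows starting from the row `r`, of lengths `d - 1, …, 0`. -/
def rowsWord : ℕ → ℕ → List (ℕ × ℕ)
  | 0, _ => []
  | d + 1, r => rowWord r d ++ rowsWord d (r + 1)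

lemma rowsWord_eq (d r : ℕ) :
    rowsWord d r = (List.range (d - 1)).flatMap (fun i => rowWord (r + i) (d - 1 - i)) := by
  induction d generalizing r with
  | zero => rfl
  | succ d ih =>
    rw [rowsWord, ih]
    cases d with
    | zero => rfl
    | succ d =>
      simp only [Nat.add_sub_cancel]
      rw [List.range_succ_eq_map, List.flatMap_cons, List.flatMap_map]
      simp only [add_zero, Nat.sub_zero, Nat.succ_eq_add_one]
      congr 2
      funext i
      congr 1 <;> omega

lemma triWord_eq (n : ℕ) : triWord n = rowsWord n 0 := by
  rw [rowsWord_eq]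
  simp only [triWord, rowWord, zero_add]

lemma reducedRun_rowWord (P : Finset (ℕ × ℕ)) (r k : ℕ) (u : Equiv.Perm ℕ)
    (K : Equiv.Perm ℕ → Prop) (K' : List ℕ → ℕ → Prop)
    (hK : ∀ v : Equiv.Perm ℕ, (∀ q, q < r ∨ r + k < q → v q = u q) →
      (K v ↔ K' (revVals v (r + 1) k) (v r))) :
    ReducedRun P (rowWord r k) u K ↔
      Sweep (fun c => (r, c) ∉ P) (u (r + k)) (revVals u r k) K' := by
  induction k generalizing u K K' with
  | zero => simpa [rowWord, ReducedRun, revVals, Sweep] using hK u fun _ _ => rfl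
  | succ k ih =>
    simp only [rowWord_succ, ReducedRun, revVals, Sweep, length_revVals]
    by_cases hP : (r, k) ∈ P
    · simp only [hP, if_true, not_true, if_false]
      refine and_congr_right fun _ => ?_
      have hs : ∀ q, q ≠ r + k → q ≠ r + k + 1 →
          (u * Equiv.swap (r + k) (r + k + 1)) q = u q := fun q h1 h2 => by
        simp [Equiv.swap_apply_of_ne_of_ne h1 h2]
      refine (ih _ K (fun l t => K' (u (r + k) :: l) t) ?_).trans ?_
      rotate_left
      · rw [Equiv.Perm.mul_apply, Equiv.swap_apply_left,
          revVals_congr fun q _ h => hs q (by omega) (by omega)]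
        rfl
      · intro v hv
        rw [hK v fun q hq => by rw [hv q (by omega), hs q (by omega) (by omega)]]
        simp only [revVals]
        rw [show r + 1 + k = r + k + 1 by omega, hv _ (by omega)]
        simp
    · simp only [hP, if_false, not_false_eq_true, if_true]
      refine ih u K (fun l t => K' (u (r + (k + 1)) :: l) t) ?_
      intro v hv
      rw [hK v fun q hq => hv q (by omega)]
      simp only [revVals]
      rw [show r + 1 + k = r + (k + 1) by omega, hv _ (by omega)]

lemma ReducedRun.apply_eq {P : Finset (ℕ × ℕ)} {l : List (ℕ × ℕ)} {u w : Equiv.Perm ℕ} {q : ℕ}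
    (h : ReducedRun P l u (· = w)) (hl : ∀ b ∈ l, q < b.1 + b.2) : w q = u q := by
  induction l generalizing u with
  | nil => exact (congrArg (· q) h).symm
  | cons b l ih =>
    have hb := hl b List.mem_cons_self
    simp only [ReducedRun] at h
    split_ifs at h
    · rw [ih h.2 fun b hb => hl b (List.mem_cons_of_mem _ hb), Equiv.Perm.mul_apply,
        Equiv.swap_apply_of_ne_of_ne (by omega) (by omega)]
    · exact ih h fun b hb => hl b (List.mem_cons_of_mem _ hb)

lemma le_of_mem_rowsWord {d r : ℕ} {b : ℕ × ℕ} (h : b ∈ rowsWord d r) : r ≤ b.1 + b.2 := by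
  simp only [rowsWord_eq, rowWord, List.mem_flatMap, List.mem_map] at h
  obtain ⟨i, -, c, -, rfl⟩ := h
  dsimp only
  omega

lemma sweep_congr {B B' : ℕ → Prop} {x : ℕ} {ys : List ℕ} {K K' : List ℕ → ℕ → Prop}
    (hB : ∀ c < ys.length, (B c ↔ B' c)) (hK : ∀ l t, K l t ↔ K' l t) :
    Sweep B x ys K ↔ Sweep B' x ys K' := by
  induction ys generalizing x K K' with
  | nil => exact hK _ _
  | cons y ys ih =>
    have hB' : ∀ c < ys.length, (B c ↔ B' c) := fun c hc => hB c (by simp; omega)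
    simp only [Sweep, hB ys.length (by simp)]
    split_ifs
    · exact ih hB' fun l t => hK _ _
    · exact and_congr_right fun _ => ih hB' fun l t => hK _ _

lemma piPerm_apply (n i : ℕ) : piPerm n i = if 1 ≤ i ∧ i < n then n - i else i := rfl

lemma reducedRun_rowsWord {P : Finset (ℕ × ℕ)} {n : ℕ} {E : ℕ → ℕ → Prop}
    (hE : ∀ c j, c < j → j < n → (E c j ↔ (n - 1 - j, c) ∉ P)) (d : ℕ) (hd : d < n)
    (u : Equiv.Perm ℕ) (hu : ∀ q, q < n - d ∨ n ≤ q → u q = piPerm n q) :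
    ReducedRun P (rowsWord d (n - d)) u (· = piPerm n) ↔ Sweeps E d (revVals u (n - d) d) := by
  induction d generalizing u with
  | zero =>
    simp only [rowsWord, ReducedRun, Sweeps, iff_true]
    ext q
    exact hu q (by omega)
  | succ d ih =>
    have hpi : piPerm n (n - (d + 1)) = d + 1 := by
      rw [piPerm_apply, if_pos (by omega)]
      omega
    rw [rowsWord, reducedRun_append]
    refine (reducedRun_rowWord P (n - (d + 1)) d u _
      (fun l t => t = d + 1 ∧ Sweeps E d l) ?_).trans ?_
    · intro v hv
      rw [show n - (d + 1) + 1 = n - d by omega]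
      have key : v (n - (d + 1)) = d + 1 →
          (ReducedRun P (rowsWord d (n - d)) v (· = piPerm n) ↔
            Sweeps E d (revVals v (n - d) d)) := by
        intro h
        refine ih (by omega) v fun q hq => ?_
        by_cases hq' : q = n - (d + 1)
        · rw [hq', h, hpi]
        · rw [hv q (by omega), hu q (by omega)]
      constructor
      · intro h
        have := h.apply_eq (q := n - (d + 1)) fun b hb => by
          have := le_of_mem_rowsWord hb
          omega
        rw [hpi] at this
        exact ⟨this.symm, (key this.symm).1 h⟩
      · rintro ⟨h, h'⟩
        exact (key h).2 h'
    · simp only [Sweeps, revVals]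
      refine sweep_congr (fun c hc => ?_) fun _ _ => Iff.rfl
      rw [length_revVals] at hc
      rw [hE c d hc (by omega), show n - 1 - d = n - (d + 1) by omega]

/-- The list obtained from `x, k - 1, …, 0` by a sweep with elbows in the columns in `A`. -/
noncomputable def topRow (A : ℕ → Prop) : ℕ → ℕ → List ℕ
  | _, 0 => []
  | x, k + 1 => if A k then x :: topRow A k k else k :: topRow A x k

lemma sweep_revVals_id {A : ℕ → Prop} {x k : ℕ} (hx : k < x) (K : List ℕ → Prop) :
    Sweep A x (revVals id 0 (k + 1)) (fun l t => t = 0 ∧ K l) ↔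
      A 0 ∧ K (topRow A x (k + 1)) := by
  induction k generalizing x K with
  | zero =>
    by_cases h : A 0
    · simp [revVals, Sweep, topRow, h]
    · simp [revVals, Sweep, topRow, h]
      omega
  | succ k ih =>
    rw [revVals, Sweep, length_revVals, topRow]
    by_cases h : A (k + 1)
    · simp only [h, if_true]
      simpa using ih (x := k + 1) (by omega) fun l => K (x :: l)
    · simp only [h, if_false]
      simpa [hx] using ih (x := x) (by omega) fun l => K ((k + 1) :: l)

lemma reducedRun_triWord {P : Finset (ℕ × ℕ)} {N : ℕ} (hN : 1 ≤ N) {E : ℕ → ℕ → Prop}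
    (hE : ∀ c j, c < j → j ≤ N → (E c j ↔ (N - j, c) ∉ P)) :
    ReducedRun P (triWord (N + 1)) 1 (· = piPerm (N + 1)) ↔
      E 0 N ∧ Sweeps E N (topRow (E · N) N N) := by
  obtain ⟨k, rfl⟩ : ∃ k, N = k + 1 := ⟨N - 1, by omega⟩
  have hpi : piPerm (k + 1 + 1) 0 = 0 := by
    simp [piPerm_apply]
  rw [triWord_eq, rowsWord, reducedRun_append,
    ← sweep_revVals_id (A := (E · (k + 1))) (Nat.lt_succ_self k) (Sweeps E (k + 1))]
  refine (reducedRun_rowWord P 0 (k + 1) 1 _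
      (fun l t => t = 0 ∧ Sweeps E (k + 1) l) ?_).trans ?_
  · intro v hv
    have key : v 0 = 0 →
        (ReducedRun P (rowsWord (k + 1) (0 + 1)) v (· = piPerm (k + 1 + 1)) ↔
          Sweeps E (k + 1) (revVals v (0 + 1) (k + 1))) := by
      intro h
      have := reducedRun_rowsWord (n := k + 1 + 1) (E := E) (P := P)
        (fun c j h h' => by simpa using hE c j h (by omega)) (k + 1) (by omega) v ?_
      · simpa using this
      · intro q hq
        rcases hq with hq | hq
        · obtain rfl : q = 0 := by omega
          rw [h, hpi]
        · rw [hv q (by omega), piPerm_apply, if_neg (by omega)]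
          rfl
    constructor
    · intro h
      have := h.apply_eq (q := 0) fun b hb => by
        have := le_of_mem_rowsWord hb
        omega
      rw [hpi] at this
      exact ⟨this.symm, (key this.symm).1 h⟩
    · rintro ⟨h, h'⟩
      exact (key h).2 h'
  · rw [zero_add]
    refine sweep_congr (fun c hc => ?_) fun _ _ => Iff.rfl
    rw [length_revVals] at hc
    simpa using (hE c (k + 1) hc le_rfl).symm

/-! ### The recursion removing the top vertex -/

lemma length_topRow (A : ℕ → Prop) (x k : ℕ) : (topRow A x k).length = k := by
  induction k generalizing x with
  | zero => rfl
  | succ k ih => rw [topRow]; split_ifs <;> simp [ih]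

lemma topRow_congr {A A' : ℕ → Prop} {x k : ℕ} (h : ∀ c < k, (A c ↔ A' c)) :
    topRow A x k = topRow A' x k := by
  induction k generalizing x with
  | zero => rfl
  | succ k ih =>
    simp only [topRow, h k (by omega), ih fun c hc => h c (by omega)]

lemma lt_of_mem_topRow {A : ℕ → Prop} {N x k : ℕ} (hx : x < N) (hk : k ≤ N) :
    ∀ y ∈ topRow A x k, y < N := by
  induction k generalizing x with
  | zero => simp [topRow]
  | succ k ih =>
    rw [topRow]
    split_ifs
    · simpa [hx] using ih (x := k) (by omega) (by omega)
    · simpa [show k < N by omega] using ih hx (by omega)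

lemma not_sweep_of_lt {B : ℕ → Prop} {N x : ℕ} {ys : List ℕ} (hx : x < N)
    (hys : ∀ y ∈ ys, y < N) (K : List ℕ → Prop) :
    ¬ Sweep B x ys (fun l t => t = N ∧ K l) := by
  induction ys generalizing x K with
  | nil => simp [Sweep]; omega
  | cons y ys ih =>
    simp only [List.mem_cons, forall_eq_or_imp] at hys
    rw [Sweep]
    split_ifs
    · exact ih hys.1 hys.2 fun l => K (x :: l)
    · exact fun h => ih hx hys.2 (fun l => K (y :: l)) h.2

lemma sweep_max {B : ℕ → Prop} {N : ℕ} {ys : List ℕ} (hys : ∀ y ∈ ys, y < N)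
    (K : List ℕ → Prop) :
    Sweep B N ys (fun l t => t = N ∧ K l) ↔ (∀ c < ys.length, ¬ B c) ∧ K ys := by
  induction ys generalizing K with
  | nil => simp [Sweep]
  | cons y ys ih =>
    simp only [List.mem_cons, forall_eq_or_imp] at hys
    rw [Sweep, List.length_cons, Nat.forall_lt_succ_right]
    by_cases h : B ys.length
    · simpa [h] using not_sweep_of_lt hys.1 hys.2 fun l => K (N :: l)
    · simpa [h, hys.1] using ih hys.2 fun l => K (y :: l)

lemma sweep_topRow {A B : ℕ → Prop} {N x k : ℕ} (hx : x < N) (hkx : k ≤ x)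
    (hA : ∃ a < k, A a) (K : List ℕ → Prop) :
    Sweep B x (topRow A N k) (fun l t => t = N ∧ K l) ↔
      (∃ m < k, A m ∧ (∀ c < k, m < c → ¬ A c) ∧ (∀ c < m, ¬ B c) ∧ B m) ∧
        K (topRow (fun c => A c ∨ B c) x k) := by
  induction k generalizing x K with
  | zero => simp at hA
  | succ k ih =>
    rw [topRow, topRow]
    by_cases hAk : A k
    · have hm : (∃ m < k + 1, A m ∧ (∀ c < k + 1, m < c → ¬ A c) ∧ (∀ c < m, ¬ B c) ∧ B m) ↔
          (∀ c < k, ¬ B c) ∧ B k := by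
        constructor
        · rintro ⟨m, h1, h2, h3, h4⟩
          obtain rfl : m = k := by
            by_contra
            exact h3 k (by omega) (by omega) hAk
          exact h4
        · exact fun h => ⟨k, by omega, hAk, fun c _ _ => by omega, h⟩
      rw [hm]
      simp only [hAk, true_or, if_true, Sweep, length_topRow]
      by_cases hB : B k
      · simp only [hB, if_true, and_true]
        refine (sweep_max (lt_of_mem_topRow (by omega) (by omega)) fun l => K (x :: l)).trans ?_
        rw [length_topRow]
        refine and_congr_right fun h => ?_
        rw [topRow_congr fun c hc => (by simp [h c hc] : A c ↔ A c ∨ B c)]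
      · simp only [hB, if_false, and_false, false_and, iff_false]
        omega
    · obtain ⟨a, ha, hAa⟩ := hA
      have hak : a ≠ k := by rintro rfl; exact hAk hAa
      have hm : (∃ m < k + 1, A m ∧ (∀ c < k + 1, m < c → ¬ A c) ∧ (∀ c < m, ¬ B c) ∧ B m) ↔
          ∃ m < k, A m ∧ (∀ c < k, m < c → ¬ A c) ∧ (∀ c < m, ¬ B c) ∧ B m := by
        refine exists_congr fun m => ?_
        constructor
        · rintro ⟨h1, h2, h3, h4⟩
          have : m ≠ k := by rintro rfl; exact hAk h2
          exact ⟨by omega, h2, fun c hc => h3 c (by omega), h4⟩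
        · rintro ⟨h1, h2, h3, h4⟩
          refine ⟨by omega, h2, fun c hc hmc => ?_, h4⟩
          by_cases hck : c = k
          · rwa [hck]
          · exact h3 c (by omega) hmc
      rw [hm]
      simp only [hAk, false_or, if_false, Sweep, length_topRow]
      by_cases hB : B k
      · simp only [hB, if_true]
        exact ih (x := k) (by omega) le_rfl ⟨a, by omega, hAa⟩ fun l => K (x :: l)
      · simp only [hB, if_false, show k < x by omega, true_and]
        exact ih hx (by omega) ⟨a, by omega, hAa⟩ fun l => K (k :: l)

/-- The condition on two consecutive top vertices `j + 1` and `j` with smaller neighbours `A` and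
`B`: the vertices in `B` are at least `m = max A`, with equality for one of them if `m < j`. -/
def TopCompatible (A B : ℕ → Prop) (j : ℕ) : Prop :=
  ∃ m ≤ j, A m ∧ (∀ c ≤ j, m < c → ¬ A c) ∧ (∀ c < m, ¬ B c) ∧ (m < j → B m)

lemma sweeps_topRow {E : ℕ → ℕ → Prop} {A : ℕ → Prop} {j : ℕ} (hA : ∃ a ≤ j, A a) :
    Sweeps E (j + 1) (topRow A (j + 1) (j + 1)) ↔
      TopCompatible A (E · j) j ∧ Sweeps E j (topRow (fun c => A c ∨ E c j) j j) := by
  rw [topRow, TopCompatible]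
  by_cases hj : A j
  · have hm : (∃ m ≤ j, A m ∧ (∀ c ≤ j, m < c → ¬ A c) ∧ (∀ c < m, ¬ E c j) ∧ (m < j → E m j)) ↔
        ∀ c < j, ¬ E c j := by
      constructor
      · rintro ⟨m, h1, h2, h3, h4⟩
        obtain rfl : m = j := by
          by_contra
          exact h3 j (by omega) (by omega) hj
        exact h4.1
      · exact fun h => ⟨j, le_rfl, hj, fun c _ _ => by omega, h, fun h => by omega⟩
    rw [if_pos hj, hm, Sweeps, sweep_max (lt_of_mem_topRow (by omega) (by omega)), length_topRow]
    refine and_congr_right fun h => ?_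
    rw [topRow_congr fun c hc => (by simp [h c hc] : A c ↔ A c ∨ E c j)]
  · obtain ⟨a, ha, hAa⟩ := hA
    have haj : a ≠ j := by rintro rfl; exact hj hAa
    rw [if_neg hj, Sweeps, sweep_topRow (by omega) le_rfl ⟨a, by omega, hAa⟩]
    refine and_congr_left fun _ => exists_congr fun m => ?_
    constructor
    · rintro ⟨h1, h2, h3, h4, h5⟩
      refine ⟨by omega, h2, fun c hc hmc => ?_, h4, fun _ => h5⟩
      by_cases hcj : c = j
      · rwa [hcj]
      · exact h3 c (by omega) hmc
    · rintro ⟨h1, h2, h3, h4, h5⟩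
      have : m ≠ j := by rintro rfl; exact hj h2
      exact ⟨by omega, h2, fun c hc => h3 c (by omega), h4, h5 (by omega)⟩

lemma sweeps_congr {E E' : ℕ → ℕ → Prop} {j : ℕ} {l : List ℕ}
    (h : ∀ c i, i < j → (E c i ↔ E' c i)) : Sweeps E j l ↔ Sweeps E' j l := by
  induction j generalizing l with
  | zero => rfl
  | succ j ih =>
    cases l with
    | nil => rfl
    | cons x ys =>
      exact sweep_congr (fun c _ => h c j (by omega)) fun l t =>
        and_congr_right fun _ => ih fun c i hi => h c i (by omega)

/-- The graph on `{0,…,j}` obtained from a graph on `{0,…,j+1}` by merging `j + 1` into `j`. -/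
def mergeTop (E : ℕ → ℕ → Prop) (j : ℕ) (c i : ℕ) : Prop :=
  (i < j ∧ E c i) ∨ (i = j ∧ c < j ∧ (E c (j + 1) ∨ E c j))

/-- The recursive description of the elbows of reduced pipe dreams, for the graph `E` on
`{0,…,N}`. -/
def SweepGraph (E : ℕ → ℕ → Prop) (N : ℕ) : Prop :=
  E 0 N ∧ Sweeps E N (topRow (E · N) N N)

lemma sweepGraph_one {E : ℕ → ℕ → Prop} : SweepGraph E 1 ↔ E 0 1 := by
  by_cases h : E 0 1 <;> simp [SweepGraph, Sweeps, topRow, Sweep, h]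

lemma sweepGraph_succ {E : ℕ → ℕ → Prop} {j : ℕ} (hj : 1 ≤ j) :
    SweepGraph E (j + 1) ↔
      E 0 (j + 1) ∧ TopCompatible (E · (j + 1)) (E · j) j ∧ SweepGraph (mergeTop E j) j := by
  refine and_congr_right fun h0 => ?_
  rw [sweeps_topRow ⟨0, by omega, h0⟩]
  refine and_congr_right fun _ => ?_
  have h0' : mergeTop E j 0 j := Or.inr ⟨rfl, by omega, Or.inl h0⟩
  simp only [SweepGraph, h0', true_and]
  rw [topRow_congr (A' := (mergeTop E j · j)) fun c hc => by simp [mergeTop, hc]]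
  exact sweeps_congr fun c i hi => by simp [mergeTop, hi, hi.ne]

/-! ### Connected noncrossing alternating graphs -/

/-- `E` is a connected noncrossing alternating graph on `{0,…,N}`. -/
structure IsConnectedNoncrossingAlternating (E : ℕ → ℕ → Prop) (N : ℕ) : Prop where
  edge : ∀ {a b}, E a b → a < b ∧ b ≤ N
  alternating : ∀ {a b c}, E a b → E b c → False
  noncrossing : ∀ {i p k l}, i < p → p < k → k < l → E i k → E p l → False
  connected : ∀ {a}, a ≤ N → Relation.EqvGen E 0 a

lemma exists_edge_of_eqvGen {E : ℕ → ℕ → Prop} {a b : ℕ} (h : Relation.EqvGen E a b)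
    (S : ℕ → Prop) (ha : S a) (hb : ¬ S b) : ∃ x y, ¬ S x ∧ S y ∧ (E x y ∨ E y x) := by
  by_contra hcon
  have key : S a ↔ S b := by
    clear ha hb
    induction h with
    | rel x y hxy => by_contra; apply hcon; grind
    | refl x => rfl
    | symm x y _ ih => exact ih.symm
    | trans x y z _ _ ih1 ih2 => exact ih1.trans ih2
  exact hb (key.1 ha)

section Merge

variable {E : ℕ → ℕ → Prop} {j : ℕ}

lemma IsConnectedNoncrossingAlternating.topCompatible
    (h : IsConnectedNoncrossingAlternating E (j + 1)) (hj : 1 ≤ j) :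
    TopCompatible (E · (j + 1)) (E · j) j := by
  have hA : ∃ a, E a (j + 1) := by
    obtain ⟨x, y, hx, rfl, hxy | hxy⟩ := exists_edge_of_eqvGen
      (h.connected le_rfl).symm (· = j + 1) rfl (by omega)
    · exact ⟨x, hxy⟩
    · have := h.edge hxy
      omega
  obtain ⟨a, ha⟩ := hA
  have hex := Nat.findGreatest_spec (P := (E · (j + 1))) (n := j)
    (by have := h.edge ha; omega) ha
  have hmax : ∀ c ≤ j, Nat.findGreatest (E · (j + 1)) j < c → ¬ E c (j + 1) :=
    fun c hc hmc => Nat.findGreatest_is_greatest (P := (E · (j + 1))) hmc hc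
  have hle : Nat.findGreatest (E · (j + 1)) j ≤ j := Nat.findGreatest_le j
  generalize Nat.findGreatest (E · (j + 1)) j = m at hex hmax hle
  refine ⟨m, hle, hex, hmax, fun c hc hE => ?_, fun hmj => ?_⟩
  · rcases hle.lt_or_eq with hlt | rfl
    · exact h.noncrossing hc hlt (by omega) hE hex
    · exact h.alternating hE hex
  by_contra hmE
  have hexit : ∀ v, m ≤ v → v < j → (v = m ∨ E m v) → ∃ x, v < x ∧ x ≤ j ∧ E m x := by
    intro v hmv hvj hv
    obtain ⟨x, y, hx, hy, hxy⟩ := exists_edge_of_eqvGen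
      ((h.connected (a := j) (by omega)).symm.trans _ _ _ (h.connected (a := m) (by omega)))
      (fun z => v < z ∧ z ≤ j) (by omega) (by omega)
    rcases hxy with hxy | hxy
    · have hlt := (h.edge hxy).1
      rcases lt_trichotomy x m with hxm | rfl | hxm
      · exact (h.noncrossing hxm (by omega) (by omega) hxy hex).elim
      · exact ⟨y, hy.1, hy.2, hxy⟩
      · rcases hv with rfl | hv
        · omega
        · rcases lt_trichotomy x v with hxv | rfl | hxv
          · exact (h.noncrossing hxm hxv hy.1 hv hxy).elim
          · exact (h.alternating hv hxy).elim
          · omega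
    · have := h.edge hxy
      obtain rfl : x = j + 1 := by omega
      exact (hmax y hy.2 (by omega) hxy).elim
  obtain ⟨v, hmv, hvj, hv⟩ := hexit m le_rfl hmj (Or.inl rfl)
  have hex' := Nat.findGreatest_spec (P := (E m ·)) hvj hv
  have hv' : m < Nat.findGreatest (E m ·) j := (h.edge hex').1
  have hvj' : Nat.findGreatest (E m ·) j ≤ j := Nat.findGreatest_le j
  obtain ⟨x, h1, h2, h3⟩ := hexit _ hv'.le
    (lt_of_le_of_ne hvj' fun heq => hmE (by rw [heq] at hex'; exact hex')) (Or.inr hex')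
  exact Nat.findGreatest_is_greatest h1 h2 h3

lemma IsConnectedNoncrossingAlternating.mergeTop
    (h : IsConnectedNoncrossingAlternating E (j + 1)) (hj : 1 ≤ j) :
    IsConnectedNoncrossingAlternating (mergeTop E j) j where
  edge := by
    rintro a b (⟨hb, hab⟩ | ⟨rfl, hab, -⟩)
    · exact ⟨(h.edge hab).1, hb.le⟩
    · exact ⟨hab, le_rfl⟩
  alternating := by
    rintro a b c (⟨hb, hab⟩ | ⟨rfl, hab, -⟩) (⟨hc, hbc⟩ | ⟨rfl, hbc, hbc' | hbc'⟩)
    · exact h.alternating hab hbc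
    · exact h.alternating hab hbc'
    · exact h.alternating hab hbc'
    · have := h.edge hbc
      omega
    · omega
    · omega
  noncrossing := by
    rintro i p k l hip hpk hkl (⟨hk, hik⟩ | ⟨rfl, hik, -⟩) (⟨hl, hpl⟩ | ⟨rfl, hpl, hpl' | hpl'⟩)
    · exact h.noncrossing hip hpk hkl hik hpl
    · exact h.noncrossing hip hpk (by omega) hik hpl'
    · exact h.noncrossing hip hpk (by omega) hik hpl'
    all_goals omega
  connected := by
    have key : ∀ a b, Relation.EqvGen E a b →
        Relation.EqvGen (_root_.mergeTop E j) (min a j) (min b j) := by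
      intro a b hab
      induction hab with
      | rel x y hxy =>
        have hlt := h.edge hxy
        by_cases hxj : x = j
        · rw [min_eq_right hxj.ge, min_eq_right (by omega)]
          exact .refl _
        · rw [min_eq_left (by omega)]
          refine .rel _ _ ?_
          by_cases hy : y < j
          · rw [min_eq_left hy.le]
            exact Or.inl ⟨hy, hxy⟩
          · rw [min_eq_right (by omega)]
            refine Or.inr ⟨rfl, by omega, ?_⟩
            rcases (show y = j ∨ y = j + 1 by omega) with rfl | rfl
            · exact Or.inr hxy
            · exact Or.inl hxy
      | refl x => exact .refl _
      | symm x y _ ih => exact ih.symm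
      | trans x y z _ _ ih1 ih2 => exact ih1.trans _ _ _ ih2
    intro a ha
    simpa [ha] using key 0 a (h.connected (by omega))

lemma IsConnectedNoncrossingAlternating.of_mergeTop
    (hE : ∀ {a b}, E a b → a < b ∧ b ≤ j + 1) (hc : TopCompatible (E · (j + 1)) (E · j) j)
    (h : IsConnectedNoncrossingAlternating (_root_.mergeTop E j) j) :
    IsConnectedNoncrossingAlternating E (j + 1) where
  edge := hE
  alternating := by
    obtain ⟨m, hmj, hm, hmax, hmin, hB⟩ := hc
    have lift : ∀ {a b}, E a b → a < j → _root_.mergeTop E j a (min b j) := by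
      intro a b hab ha
      have := hE hab
      by_cases hb : b < j
      · exact Or.inl ⟨by omega, by rwa [min_eq_left hb.le]⟩
      · refine Or.inr ⟨by omega, ha, ?_⟩
        rcases (show b = j ∨ b = j + 1 by omega) with rfl | rfl
        · exact Or.inr hab
        · exact Or.inl hab
    intro a b c hab hbc
    have h1 := hE hab
    have h2 := hE hbc
    by_cases hb : b < j
    · have h3 := lift hab (by omega)
      rw [min_eq_left hb.le] at h3
      exact h.alternating h3 (lift hbc hb)
    · obtain rfl : b = j := by omega
      obtain rfl : c = b + 1 := by omega
      obtain rfl : m = b := by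
        by_contra
        exact hmax b le_rfl (by omega) hbc
      exact hmin a h1.1 hab
  noncrossing := by
    obtain ⟨m, hmj, hm, hmax, hmin, hB⟩ := hc
    intro i p k l hip hpk hkl hik hpl
    have h1 := hE hik
    have h2 := hE hpl
    by_cases hk : k < j
    · have h3 : _root_.mergeTop E j i k := Or.inl ⟨hk, hik⟩
      rcases (show l < j ∨ l = j ∨ l = j + 1 by omega) with hl | rfl | rfl
      · exact h.noncrossing hip hpk hkl h3 (Or.inl ⟨hl, hpl⟩)
      · exact h.noncrossing hip hpk hkl h3 (Or.inr ⟨rfl, by omega, Or.inr hpl⟩)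
      · exact h.noncrossing hip hpk hk h3 (Or.inr ⟨rfl, by omega, Or.inl hpl⟩)
    · obtain rfl : k = j := by omega
      obtain rfl : l = k + 1 := by omega
      refine hmin i ?_ hik
      by_contra
      exact hmax p (by omega) (by omega) hpl
  connected := by
    obtain ⟨m, hmj, hm, hmax, hmin, hB⟩ := hc
    have htop : Relation.EqvGen E (j + 1) j := by
      rcases hmj.lt_or_eq with hlt | rfl
      · exact (Relation.EqvGen.rel _ _ hm).symm.trans _ _ _ (.rel _ _ (hB hlt))
      · exact (Relation.EqvGen.rel _ _ hm).symm
    have key : ∀ a b, Relation.EqvGen (_root_.mergeTop E j) a b → Relation.EqvGen E a b := by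
      intro a b hab
      induction hab with
      | rel x y hxy =>
        rcases hxy with ⟨-, hxy⟩ | ⟨rfl, -, hxy | hxy⟩
        · exact .rel _ _ hxy
        · exact (Relation.EqvGen.rel _ _ hxy).trans _ _ _ htop
        · exact .rel _ _ hxy
      | refl x => exact .refl _
      | symm x y _ ih => exact ih.symm
      | trans x y z _ _ ih1 ih2 => exact ih1.trans _ _ _ ih2
    intro a ha
    rcases Nat.le_succ_iff.1 ha with ha | rfl
    · exact key _ _ (h.connected ha)
    · exact (key _ _ (h.connected le_rfl)).trans _ _ _ htop.symm

end Merge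

lemma sweepGraph_iff {E : ℕ → ℕ → Prop} {N : ℕ} (hN : 1 ≤ N)
    (hE : ∀ {a b}, E a b → a < b ∧ b ≤ N) :
    SweepGraph E N ↔ IsConnectedNoncrossingAlternating E N := by
  induction N, hN using Nat.le_induction generalizing E with
  | base =>
    rw [sweepGraph_one]
    constructor
    · intro h
      refine ⟨hE, ?_, ?_, ?_⟩
      · intro a b c hab hbc
        have := hE hab
        have := hE hbc
        omega
      · intro i p k l _ _ _ hik hpl
        have := hE hik
        have := hE hpl
        omega
      · intro a ha
        rcases Nat.le_one_iff_eq_zero_or_eq_one.1 ha with rfl | rfl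
        · exact .refl _
        · exact .rel _ _ h
    · intro h
      obtain ⟨x, y, hx, rfl, hxy | hxy⟩ := exists_edge_of_eqvGen
        (h.connected le_rfl).symm (· = 1) rfl (by omega)
      · have := h.edge hxy
        obtain rfl : x = 0 := by omega
        exact hxy
      · have := h.edge hxy
        omega
  | succ j hj ih =>
    have hE' : ∀ {a b}, mergeTop E j a b → a < b ∧ b ≤ j := by
      rintro a b (⟨hb, hab⟩ | ⟨rfl, hab, -⟩)
      · exact ⟨(hE hab).1, hb.le⟩
      · exact ⟨hab, le_rfl⟩
    rw [sweepGraph_succ hj, ih hE']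
    constructor
    · exact fun ⟨_, hc, h⟩ => .of_mergeTop hE hc h
    · intro h
      have hc := h.topCompatible hj
      have h' := h.mergeTop hj
      refine ⟨?_, hc, h'⟩
      rcases ((ih hE').2 h').1 with ⟨hlt, -⟩ | ⟨-, -, h0 | h0⟩
      · omega
      · exact h0
      · obtain ⟨m, -, hm, -, hmin, -⟩ := hc
        obtain rfl : m = 0 := by
          by_contra
          exact hmin 0 (by omega) h0
        exact hm

/-! ### Spanning trees -/

lemma graphOf_adj {T : Finset (ℕ × ℕ)} {a b : ℕ} :
    (graphOf T).Adj a b ↔ ((a, b) ∈ T ∨ (b, a) ∈ T) ∧ a ≠ b := by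
  simp only [graphOf, SimpleGraph.fromEdgeSet_adj, Finset.coe_image, Set.mem_image,
    Finset.mem_coe, Prod.exists, Sym2.eq_iff]
  grind

lemma reachable_graphOf_iff {T : Finset (ℕ × ℕ)} {a b : ℕ} :
    (graphOf T).Reachable a b ↔ Relation.EqvGen (fun c i => (c, i) ∈ T) a b := by
  rw [SimpleGraph.reachable_iff_reflTransGen]
  constructor
  · intro h
    induction h with
    | refl => exact .refl _
    | tail _ h ih =>
      refine ih.trans _ _ _ ?_
      rcases (graphOf_adj.1 h).1 with h | h
      · exact .rel _ _ h
      · exact (Relation.EqvGen.rel _ _ h).symm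
  · rw [← SimpleGraph.reachable_iff_reflTransGen]
    intro h
    induction h with
    | rel x y h =>
      by_cases hxy : x = y
      · rw [hxy]
      · exact (graphOf_adj.2 ⟨Or.inl h, hxy⟩).reachable
    | refl x => rfl
    | symm x y _ ih => exact ih.symm
    | trans x y z _ _ ih1 ih2 => exact ih1.trans ih2

lemma SimpleGraph.Walk.support_subset_of_adj {V : Type*} {G : SimpleGraph V} {s : Set V}
    (hG : ∀ {a b}, G.Adj a b → b ∈ s) {u v : V} (w : G.Walk u v) (hu : u ∈ s) :
    ∀ x ∈ w.support, x ∈ s := by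
  induction w with
  | nil => simpa using hu
  | cons h w ih =>
    simp only [SimpleGraph.Walk.support_cons, List.mem_cons, forall_eq_or_imp]
    exact ⟨hu, ih (hG h)⟩

lemma SimpleGraph.isAcyclic_of_reachable_of_ncard_edgeSet {V : Type*} {G : SimpleGraph V}
    {s : Set V} (hs : s.Finite) (hne : s.Nonempty) (hG : ∀ {a b}, G.Adj a b → b ∈ s)
    (hfin : G.edgeSet.Finite) (hcard : G.edgeSet.ncard + 1 ≤ s.ncard)
    (hreach : ∀ a ∈ s, ∀ b ∈ s, G.Reachable a b) : G.IsAcyclic := by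
  have : Finite s := hs
  have : Finite G.edgeSet := hfin
  have : Nonempty s := hne.to_subtype
  have hconn : (G.induce s).Connected := by
    refine ⟨fun ⟨a, ha⟩ ⟨b, hb⟩ => ?_⟩
    obtain ⟨w⟩ := hreach a ha b hb
    exact ⟨w.induce s (w.support_subset_of_adj hG ha)⟩
  have hle : Nat.card (G.induce s).edgeSet ≤ G.edgeSet.ncard :=
    Nat.card_le_card_of_injective _ (SimpleGraph.Embedding.induce s).mapEdgeSet.injective
  have htree : (G.induce s).IsTree := by
    refine SimpleGraph.isTree_iff_connected_and_card.2 ⟨hconn, le_antisymm ?_ ?_⟩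
    · rw [Nat.card_coe_set_eq s]
      omega
    · exact hconn.card_vert_le_card_edgeSet_add_one
  intro v w hw
  have hv : v ∈ s := by
    cases w with
    | nil => exact (hw.ne_nil rfl).elim
    | cons h w => exact hG h.symm
  refine htree.isAcyclic (w.induce s (w.support_subset_of_adj hG hv)) ?_
  rw [← SimpleGraph.Walk.isCycle_map_iff_of_injective
    (f := (SimpleGraph.Embedding.induce (G := G) s).toHom)
    (SimpleGraph.Embedding.induce (G := G) s).injective, SimpleGraph.Walk.map_induce]
  exact hw

lemma isSpanningTree_of_card {n : ℕ} (hn : 1 ≤ n) {T : Finset (ℕ × ℕ)}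
    (h : IsConnectedNoncrossingAlternating (fun c i => (c, i) ∈ T) (n - 1))
    (hcard : T.card + 1 ≤ n) : IsSpanningTree n T ∧ Noncrossing T ∧ Alternating T := by
  have hreach : ∀ a b, a < n → b < n → (graphOf T).Reachable a b := fun a b ha hb =>
    reachable_graphOf_iff.2
      ((h.connected (by omega)).symm.trans _ _ _ (h.connected (by omega)))
  have hsub : (graphOf T).edgeSet ⊆ ↑(T.image fun p => s(p.1, p.2)) := by
    simp only [graphOf, SimpleGraph.edgeSet_fromEdgeSet]
    exact Set.sdiff_subset
  refine ⟨⟨fun p hp => ?_, ?_, hreach⟩, ?_, ?_⟩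
  · have := h.edge (a := p.1) (b := p.2) hp
    omega
  · refine SimpleGraph.isAcyclic_of_reachable_of_ncard_edgeSet (Set.finite_Iio n)
      ⟨0, hn⟩ (fun hab => ?_) ((Finset.finite_toSet _).subset hsub) ?_
      fun a ha b hb => hreach a b ha hb
    · rcases (graphOf_adj.1 hab).1 with hab | hab <;>
      · have := h.edge hab
        simp only [Set.mem_Iio]
        omega
    · have h1 := Set.ncard_le_ncard hsub (Finset.finite_toSet _)
      rw [Set.ncard_coe_finset] at h1
      have h2 : (T.image fun p => s(p.1, p.2)).card ≤ T.card := Finset.card_image_le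
      have h3 : (Set.Iio n).ncard = n := by
        rw [Set.ncard_eq_toFinset_card', Set.toFinset_Iio, Nat.card_Iio]
      omega
  · rintro ⟨i, p, k, l, h1, h2, h3, h4, h5⟩
    exact h.noncrossing h1 h2 h3 h4 h5
  · rintro ⟨i, p, k, h1, h2, h3, h4⟩
    exact h.alternating h3 h4

lemma IsSpanningTree.isConnectedNoncrossingAlternating {n : ℕ} (hn : 1 ≤ n)
    {T : Finset (ℕ × ℕ)} (hT : IsSpanningTree n T) (hnc : Noncrossing T) (ha : Alternating T) :
    IsConnectedNoncrossingAlternating (fun c i => (c, i) ∈ T) (n - 1) where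
  edge {a b} h := by
    have := hT.1 _ h
    dsimp only at this
    omega
  alternating {a b c} h h' := ha ⟨a, b, c, (hT.1 _ h).1, (hT.1 _ h').1, h, h'⟩
  noncrossing {i p k l} h1 h2 h3 h4 h5 := hnc ⟨i, p, k, l, h1, h2, h3, h4, h5⟩
  connected {a} h := reachable_graphOf_iff.1 (hT.2.2 0 a (by omega) (by omega))

/-! ### The bijection -/

lemma mem_boxes {n r c : ℕ} : (r, c) ∈ boxes n ↔ r + c + 2 ≤ n := by
  simp only [boxes, Finset.mem_filter, Finset.mem_product, Finset.mem_range]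
  omega

lemma mem_image_boxEdge {n : ℕ} {S : Finset (ℕ × ℕ)} (hS : S ⊆ boxes n) {c j : ℕ} :
    (c, j) ∈ S.image (boxEdge n) ↔ c < j ∧ j < n ∧ (n - 1 - j, c) ∈ S := by
  simp only [Finset.mem_image, boxEdge, Prod.exists, Prod.mk.injEq]
  constructor
  · rintro ⟨r, c, h, rfl, rfl⟩
    have := mem_boxes.1 (hS h)
    refine ⟨by omega, by omega, ?_⟩
    rwa [show n - 1 - (n - 1 - r) = r by omega]
  · rintro ⟨h1, h2, h3⟩
    exact ⟨_, _, h3, rfl, by omega⟩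

lemma boxEdge_injOn (n : ℕ) : Set.InjOn (boxEdge n) (boxes n) := by
  rintro ⟨r, c⟩ h ⟨r', c'⟩ h' heq
  rw [Finset.mem_coe, mem_boxes] at h h'
  simp only [boxEdge, Prod.mk.injEq] at heq ⊢
  omega

lemma card_boxes {n : ℕ} : (boxes n).card = permLen n (piPerm n) + (n - 1) := by
  rw [← Finset.card_image_of_injOn (boxEdge_injOn n),
    ← Finset.card_filter_add_card_filter_not (s := (boxes n).image (boxEdge n))
      (fun p => 1 ≤ p.1)]
  congr 1
  · unfold permLen
    congr 1
    ext ⟨a, b⟩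
    simp only [Finset.mem_filter, mem_image_boxEdge subset_rfl, mem_boxes, Finset.mem_product,
      Finset.mem_range]
    simp only [piPerm_apply]
    split_ifs <;> omega
  · have hcard : ((Finset.Ico 1 n).image (Prod.mk 0)).card = n - 1 := by
      rw [Finset.card_image_of_injective _ (Prod.mk_right_injective (0 : ℕ)), Nat.card_Ico]
    rw [← hcard]
    congr 1
    ext ⟨a, b⟩
    simp only [Finset.mem_filter, mem_image_boxEdge subset_rfl, mem_boxes, Finset.mem_image,
      Finset.mem_Ico, Prod.mk.injEq]
    constructor
    · rintro ⟨h, h'⟩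
      exact ⟨b, by omega, by omega, rfl⟩
    · rintro ⟨b, h, rfl, rfl⟩
      omega

lemma isReducedPipeDream_piPerm_iff {n : ℕ} (hn : 2 ≤ n) {P : Finset (ℕ × ℕ)}
    (hP : P ⊆ boxes n) :
    IsReducedPipeDream n (piPerm n) P ↔ IsConnectedNoncrossingAlternating
      (fun c i => (c, i) ∈ (boxes n \ P).image (boxEdge n)) (n - 1) := by
  obtain ⟨N, rfl⟩ : ∃ N, n = N + 1 := ⟨n - 1, by omega⟩
  have hN : 1 ≤ N := by omega
  rw [isReducedPipeDream_iff, Nat.add_sub_cancel, ← sweepGraph_iff hN]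
  · simp only [hP, true_and]
    refine reducedRun_triWord
      (E := fun c i => (c, i) ∈ (boxes (N + 1) \ P).image (boxEdge (N + 1))) hN fun c j hc hj => ?_
    rw [mem_image_boxEdge Finset.sdiff_subset, Finset.mem_sdiff, mem_boxes, Nat.add_sub_cancel]
    simp only [hc, true_and, show j < N + 1 by omega, and_iff_right_iff_imp]
    omega
  · intro a b h
    rw [mem_image_boxEdge Finset.sdiff_subset] at h
    omega

/-- Sending a reduced pipe dream `P` for `1 n (n-1) ⋯ 2` to the graph on
`[n]` whose edges correspond to the elbows of `P` is a bijection onto the set of noncrossing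
alternating spanning trees of `K_n`. -/
theorem bij_reducedPipeDreams_trees (n : ℕ) (hn : 2 ≤ n) :
    Set.BijOn (fun P => (boxes n \ P).image (boxEdge n))
      {P | IsReducedPipeDream n (piPerm n) P}
      {T | IsSpanningTree n T ∧ Noncrossing T ∧ Alternating T} := by
  refine ⟨fun P hP => ?_, fun P hP Q hQ hPQ => ?_, fun T hT => ?_⟩
  · have hsub : P ⊆ boxes n := hP.1.1
    refine isSpanningTree_of_card (by omega) ((isReducedPipeDream_piPerm_iff hn hsub).1 hP) ?_
    have h1 : ((boxes n \ P).image (boxEdge n)).card ≤ (boxes n \ P).card :=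
      Finset.card_image_le
    have h2 := Finset.card_sdiff_add_card_eq_card hsub
    have h3 := hP.2
    have h4 := card_boxes (n := n)
    dsimp only
    omega
  · have h := Finset.image_injOn_powerset_of_injOn (boxEdge_injOn n)
      (by simp) (by simp) hPQ
    rw [← Finset.sdiff_sdiff_eq_self hP.1.1, h, Finset.sdiff_sdiff_eq_self hQ.1.1]
  · obtain ⟨hT, hnc, ha⟩ := hT
    have himage :
        (boxes n \ (boxes n).filter (fun b => boxEdge n b ∉ T)).image (boxEdge n) = T := by
      ext ⟨c, j⟩
      rw [mem_image_boxEdge Finset.sdiff_subset]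
      rw [Finset.mem_sdiff, Finset.mem_filter, mem_boxes, not_and, not_not]
      dsimp only [boxEdge]
      constructor
      · rintro ⟨h1, h2, h3, h4⟩
        have h5 := h4 h3
        rwa [show n - 1 - (n - 1 - j) = j by omega] at h5
      · intro h
        have h' := hT.1 _ h
        dsimp only at h'
        rw [show n - 1 - (n - 1 - j) = j by omega]
        exact ⟨h'.1, h'.2, by omega, fun _ => h⟩
    refine ⟨_, (isReducedPipeDream_piPerm_iff hn (Finset.filter_subset _ _)).2 ?_, himage⟩
    rw [himage]
    exact hT.isConnectedNoncrossingAlternating (by omega) hnc ha
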